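/- Let α, β, γ, δ ∈ F₃ and let G = F₃/N be the group presented by generators g₁, g₂, g₃ and relations α = β and γ = δ, where N is the normal closure of {αβ⁻¹, γδ⁻¹}. For each word w ∈ F₃ of the form αg, βg, γg, δg with g = g₁^{i₁}g₂^{i₂}g₃^{i₃}, 0 ≤ i₁, i₂, i₃ ≤ 1, fix a polynomial P_w with Φ(P_w) = [w]. Then the kernel of Φ_G (i.e. the ideal I_G of Theorem 1) is generated by K together with the polynomials P_{αg} − P_{βg} and P_{γg} − P_{δg} for g = g₁^{i₁}g₂^{i₂}g₃^{i₃}, 0 ≤ i₁, i₂, i₃ ≤ 1. -/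

import Mathlib

open MvPolynomial

noncomputable section

def skeinIdeal (R G : Type*) [CommRing R] [Group G] : Ideal (MvPolynomial G R) :=
  Ideal.span ({X (1 : G) - 2} ∪
    {p | ∃ g h : G, p = X g * X h - X (g * h) - X (g * h⁻¹)})

abbrev SkeinAlgebra (R G : Type*) [CommRing R] [Group G] :=
  MvPolynomial G R ⧸ skeinIdeal R G

def cl (R : Type*) {G : Type*} [CommRing R] [Group G] (g : G) : SkeinAlgebra R G :=
  Ideal.Quotient.mk (skeinIdeal R G) (X g)

/-- The free group on three generators. -/
abbrev F3 := FreeGroup (Fin 3)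

def g1 : F3 := FreeGroup.of 0
def g2 : F3 := FreeGroup.of 1
def g3 : F3 := FreeGroup.of 2

/-- The words `g₁, g₂, g₃, g₁g₂, g₁g₃, g₂g₃, g₁g₂g₃` indexed by the seven variables
`x₁, x₂, x₃, x₁₂, x₁₃, x₂₃, x₁₂₃`. -/
def word : Fin 7 → F3 := ![g1, g2, g3, g1 * g2, g1 * g3, g2 * g3, g1 * g2 * g3]

/-- `Φ : ℂ[x₁,…,x₁₂₃] → S(F₃;ℂ)`, `x_{i₁⋯i_k} ↦ [g_{i₁}⋯g_{i_k}]`. -/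
def Phi : MvPolynomial (Fin 7) ℂ →ₐ[ℂ] SkeinAlgebra ℂ F3 :=
  aeval fun i => cl ℂ (word i)

-- the seven variables
def x1 : MvPolynomial (Fin 7) ℂ := X 0
def x2 : MvPolynomial (Fin 7) ℂ := X 1
def x3 : MvPolynomial (Fin 7) ℂ := X 2
def x12 : MvPolynomial (Fin 7) ℂ := X 3
def x13 : MvPolynomial (Fin 7) ℂ := X 4
def x23 : MvPolynomial (Fin 7) ℂ := X 5
def x123 : MvPolynomial (Fin 7) ℂ := X 6

/-- The polynomial `K`. -/
def K : MvPolynomial (Fin 7) ℂ :=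
  x123 ^ 2 - (x12 * x3 + x13 * x2 + x23 * x1 - x1 * x2 * x3) * x123
    + x1 ^ 2 + x2 ^ 2 + x3 ^ 2 + x12 ^ 2 + x23 ^ 2 + x13 ^ 2
    - x1 * x2 * x12 - x1 * x3 * x13 - x2 * x3 * x23 + x12 * x13 * x23 - 4

/-- `g = g₁^{i₁} g₂^{i₂} g₃^{i₃}` with `0 ≤ i₁, i₂, i₃ ≤ 1`. -/
def gpow (i : Fin 2 × Fin 2 × Fin 2) : F3 :=
  g1 ^ (i.1 : ℕ) * g2 ^ (i.2.1 : ℕ) * g3 ^ (i.2.2 : ℕ)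

section SkeinAlgebra

variable {R G : Type*} [CommRing R] [Group G]

theorem cl_one : cl R (1 : G) = 2 := by
  have h : (X (1 : G) - 2 : MvPolynomial G R) ∈ skeinIdeal R G :=
    Ideal.subset_span (Or.inl rfl)
  exact ((Ideal.Quotient.mk_eq_mk_iff_sub_mem _ _).2 h).trans (map_ofNat _ 2)

theorem cl_mul (g h : G) : cl R g * cl R h = cl R (g * h) + cl R (g * h⁻¹) := by
  have h' : (X g * X h - (X (g * h) + X (g * h⁻¹)) : MvPolynomial G R) ∈ skeinIdeal R G :=
    Ideal.subset_span (Or.inr ⟨g, h, by ring⟩)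
  simpa [cl] using (Ideal.Quotient.mk_eq_mk_iff_sub_mem _ _).2 h'

theorem cl_inv (g : G) : cl R g⁻¹ = cl R g := by
  have h := cl_mul (R := R) 1 g
  rw [cl_one, one_mul, one_mul] at h
  linear_combination -h

theorem cl_mul_comm (g h : G) : cl R (g * h) = cl R (h * g) := by
  have h₁ := cl_mul (R := R) g h
  have h₂ := cl_mul (R := R) h g
  have h₃ := cl_inv (R := R) (g * h⁻¹)
  rw [mul_inv_rev, inv_inv] at h₃
  linear_combination h₂ - h₁ + h₃

theorem cl_insert (u v w : G) :
    cl R (u * v * w) + cl R (u * v⁻¹ * w) = cl R v * cl R (u * w) := by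
  rw [cl_mul_comm (u * v), cl_mul_comm (u * v⁻¹), cl_mul_comm u w, mul_comm (cl R v), cl_mul]
  simp only [mul_assoc]

theorem cl_mul_inv (g h : G) : cl R (g * h⁻¹) = cl R g * cl R h - cl R (g * h) := by
  rw [cl_mul]; ring

theorem cl_mul_self (g : G) : cl R (g * g) = cl R g ^ 2 - 2 := by
  have h := cl_mul (R := R) g g
  rw [mul_inv_cancel, cl_one] at h
  linear_combination -h

theorem cl_commutator (a b : G) : cl R (a * b * a⁻¹ * b⁻¹) =
    cl R a ^ 2 + cl R b ^ 2 + cl R (a * b) ^ 2 - cl R a * cl R b * cl R (a * b) - 2 := by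
  have h₁ := cl_mul_inv (R := R) (a * b * a⁻¹) b
  have h₂ := cl_mul_comm (R := R) (a * b) a⁻¹
  have h₃ := cl_insert (R := R) (a * b) a b
  have h₄ := cl_mul_self (R := R) (a * b)
  have h₅ := cl_insert (R := R) a b b
  rw [inv_mul_cancel_left] at h₂
  simp only [← mul_assoc, inv_mul_cancel_right] at *
  linear_combination h₁ + cl R b * h₂ - h₃ + h₄ - cl R a * h₅

theorem cl_mul_add_cl_mul_swap (a b c : G) : cl R (a * b * c) + cl R (a * c * b) =
    cl R (a * b) * cl R c + cl R (a * c) * cl R b + cl R (b * c) * cl R a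
      - cl R a * cl R b * cl R c := by
  have h₁ := cl_mul (R := R) a (b * c)
  have h₂ := cl_mul (R := R) (a * c⁻¹) b
  have h₃ := cl_mul (R := R) a c
  have h₄ := cl_insert (R := R) a c b
  simp only [← mul_assoc, mul_inv_rev] at *
  linear_combination h₄ - h₁ + h₂ + cl R b * h₃

theorem cl_mul_mul_cl_swap (a b c : G) : cl R (a * b * c) * cl R (a * c * b) =
    cl R a ^ 2 + cl R b ^ 2 + cl R c ^ 2 + cl R (a * b) ^ 2 + cl R (b * c) ^ 2
      + cl R (a * c) ^ 2 - cl R a * cl R b * cl R (a * b) - cl R a * cl R c * cl R (a * c)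
      - cl R b * cl R c * cl R (b * c) + cl R (a * b) * cl R (a * c) * cl R (b * c) - 4 := by
  have h₁ := cl_mul (R := R) (a * b * c) (b * a * c)
  have h₂ := cl_commutator (R := R) a b
  have h₃ := cl_insert (R := R) (a * b) (c * b) (a * c)
  have h₄ := cl_mul (R := R) (a * b) (a * c)
  have h₅ : cl R (a * b * c⁻¹ * a⁻¹) = cl R (b * c⁻¹) := by
    rw [cl_mul_comm]; simp [← mul_assoc]
  have h₆ := cl_mul_inv (R := R) b c
  have h₇ := cl_mul (R := R) (a * c⁻¹) (a * c)
  have h₈ : cl R (a * c⁻¹ * c⁻¹ * a⁻¹) = cl R (c * c) := by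
    rw [cl_mul_comm, ← cl_inv (c * c)]; simp [← mul_assoc]
  have h₉ := cl_mul_inv (R := R) a c
  have h₁₀ := cl_mul_self (R := R) c
  have h₁₁ : cl R (b * a * c) = cl R (a * c * b) := by rw [mul_assoc, cl_mul_comm]
  have h₁₂ := cl_mul_comm (R := R) c b
  simp only [← mul_assoc, mul_inv_rev, mul_inv_cancel_right] at *
  rw [← h₁₁, h₁, h₂]
  rw [h₁₂] at h₃
  linear_combination h₃ - cl R (b * c) * (h₄ + h₅ + h₆) + h₇ + h₈ - cl R (a * c) * h₉ + h₁₀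

/-- A function satisfying the skein relations induces a homomorphism on the skein algebra. -/
def SkeinAlgebra.lift {A : Type*} [CommRing A] [Algebra R A] (f : G → A) (h₁ : f 1 = 2)
    (hf : ∀ g h, f g * f h = f (g * h) + f (g * h⁻¹)) : SkeinAlgebra R G →ₐ[R] A :=
  Ideal.Quotient.liftₐ _ (aeval f) (by
    intro p hp
    have hle : skeinIdeal R G ≤ RingHom.ker (aeval f : MvPolynomial G R →ₐ[R] A) := by
      refine Ideal.span_le.2 ?_
      rintro _ (rfl | ⟨g, h, rfl⟩)
      · simp [RingHom.mem_ker, h₁]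
      · simp [RingHom.mem_ker, hf]
    exact hle hp)

@[simp]
theorem SkeinAlgebra.lift_cl {A : Type*} [CommRing A] [Algebra R A] (f : G → A) (h₁ : f 1 = 2)
    (hf : ∀ g h, f g * f h = f (g * h) + f (g * h⁻¹)) (g : G) :
    SkeinAlgebra.lift (R := R) f h₁ hf (cl R g) = f g := by
  exact (Ideal.Quotient.liftₐ_apply _ _ _ _).trans (aeval_X f g)

/-- The homomorphism of skein algebras induced by a homomorphism of groups. -/
def SkeinAlgebra.map {H : Type*} [Group H] (φ : G →* H) :
    SkeinAlgebra R G →ₐ[R] SkeinAlgebra R H :=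
  SkeinAlgebra.lift (fun g => cl R (φ g)) (by simp [cl_one]) (by simp [cl_mul])

/-- The character of a representation in `SL₂(R)`, as a homomorphism on the skein algebra. -/
def SkeinAlgebra.trace (ρ : G →* Matrix.SpecialLinearGroup (Fin 2) R) :
    SkeinAlgebra R G →ₐ[R] R :=
  SkeinAlgebra.lift (fun g => (ρ g : Matrix (Fin 2) (Fin 2) R).trace) (by simp) (by
    intro g h
    simp only [map_mul, map_inv, Matrix.SpecialLinearGroup.coe_mul,
      Matrix.SpecialLinearGroup.coe_inv, Matrix.adjugate_fin_two, Matrix.trace_fin_two,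
      Matrix.mul_apply, Fin.sum_univ_two]
    simp
    ring)

theorem SkeinAlgebra.subalgebra_eq_top {s : Subalgebra R (SkeinAlgebra R G)}
    (h : ∀ g, cl R g ∈ s) : s = ⊤ := by
  refine eq_top_iff.2 fun x _ => ?_
  obtain ⟨p, rfl⟩ := Ideal.Quotient.mk_surjective x
  induction p using MvPolynomial.induction_on with
  | C a => exact s.algebraMap_mem a
  | add p q hp hq => rw [map_add]; exact s.add_mem (hp trivial) (hq trivial)
  | mul_X p g hp => rw [map_mul]; exact s.mul_mem (hp trivial) (h g)

end SkeinAlgebra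

section Spanning

variable {A : Type*} [CommRing A]

/-- `f` behaves like the linear functional `w ↦ τ (y * w)` for a trace `τ` with
`w + w⁻¹ = c i` for the word `w` with index `i`. -/
def IsSkeinFunctional (c : Fin 7 → A) (f : F3 → A) : Prop :=
  ∀ i u w, f (u * word i * w) + f (u * (word i)⁻¹ * w) = c i * f (u * w)

namespace IsSkeinFunctional

variable {c : Fin 7 → A} {f : F3 → A}

theorem comp_mul_right (hf : IsSkeinFunctional c f) (v : F3) :
    IsSkeinFunctional c fun w => f (w * v) := fun i u w => by
  simpa only [mul_assoc] using hf i u (w * v)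

variable {P : AddSubgroup A}

theorem mem_of_square (hf : IsSkeinFunctional c f) (hP : ∀ i, ∀ x ∈ P, c i * x ∈ P)
    (i : Fin 7) (u w : F3) (h₀ : f (u * w) ∈ P) (h₁ : f (u * word i * w) ∈ P) :
    f (u * word i * word i * w) ∈ P := by
  have h := hf i (u * word i) w
  rw [mul_inv_cancel_right] at h
  rw [eq_sub_of_add_eq h]
  exact P.sub_mem (hP _ _ h₁) h₀

theorem mem_of_swap (hf : IsSkeinFunctional c f) (hP : ∀ i, ∀ x ∈ P, c i * x ∈ P)
    (i j k : Fin 7) (hk : word k = word i * word j) (u w : F3) (h₀ : f (u * w) ∈ P)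
    (hi : f (u * word i * w) ∈ P) (hj : f (u * word j * w) ∈ P)
    (hij : f (u * word i * word j * w) ∈ P) : f (u * word j * word i * w) ∈ P := by
  have h₁ := hf k u w
  have h₂ := hf i (u * (word j)⁻¹) w
  have h₃ := hf j u w
  have h₄ := hf j u (word i * w)
  rw [hk] at h₁
  simp only [mul_inv_rev, ← mul_assoc] at h₁ h₂ h₃ h₄
  have h : f (u * word j * word i * w) = c k * f (u * w) - f (u * word i * word j * w)
      - c i * (c j * f (u * w)) + c i * f (u * word j * w) + c j * f (u * word i * w) := by
    linear_combination h₁ - h₂ - c i * h₃ + h₄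
  rw [h]
  exact P.add_mem (P.add_mem (P.sub_mem (P.sub_mem (hP _ _ h₀) hij) (hP _ _ (hP _ _ h₀)))
    (hP _ _ hj)) (hP _ _ hi)

theorem mem_mul_generator (hf : IsSkeinFunctional c f) (hP : ∀ i, ∀ x ∈ P, c i * x ∈ P)
    (h : ∀ i, f (gpow i) ∈ P) (l : Fin 3) (i) : f (gpow i * FreeGroup.of l) ∈ P := by
  have e₀ : word 0 = g1 := rfl
  have e₁ : word 1 = g2 := rfl
  have e₂ : word 2 = g3 := rfl
  have sq₁ := hf.mem_of_square hP 0
  have sq₂ := hf.mem_of_square hP 1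
  have sq₃ := hf.mem_of_square hP 2
  have sw₁₂ := hf.mem_of_swap hP 0 1 3 rfl
  have sw₁₃ := hf.mem_of_swap hP 0 2 4 rfl
  have sw₂₃ := hf.mem_of_swap hP 1 2 5 rfl
  rw [e₀] at sq₁ sw₁₂ sw₁₃
  rw [e₁] at sq₂ sw₁₂ sw₂₃
  rw [e₂] at sq₃ sw₁₃ sw₂₃
  have h₀ : f 1 ∈ P := by simpa [gpow] using h (0, 0, 0)
  have h₁ : f g1 ∈ P := by simpa [gpow] using h (1, 0, 0)
  have h₂ : f g2 ∈ P := by simpa [gpow] using h (0, 1, 0)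
  have h₃ : f g3 ∈ P := by simpa [gpow] using h (0, 0, 1)
  have h₁₂ : f (g1 * g2) ∈ P := by simpa [gpow] using h (1, 1, 0)
  have h₁₃ : f (g1 * g3) ∈ P := by simpa [gpow] using h (1, 0, 1)
  have h₂₃ : f (g2 * g3) ∈ P := by simpa [gpow] using h (0, 1, 1)
  have h₁₂₃ : f (g1 * g2 * g3) ∈ P := by simpa [gpow] using h (1, 1, 1)
  have h₁₁ : f (g1 * g1) ∈ P := by simpa using sq₁ 1 1 (by simpa) (by simpa)
  have h₁₁₂ : f (g1 * g1 * g2) ∈ P := by simpa using sq₁ 1 g2 (by simpa) (by simpa)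
  have h₁₁₃ : f (g1 * g1 * g3) ∈ P := by simpa using sq₁ 1 g3 (by simpa) (by simpa)
  have h₁₁₂₃ : f (g1 * g1 * g2 * g3) ∈ P := by
    simpa [mul_assoc] using sq₁ 1 (g2 * g3) (by simpa) (by simpa [mul_assoc] using h₁₂₃)
  have h₂₂ : f (g2 * g2) ∈ P := by simpa using sq₂ 1 1 (by simpa) (by simpa)
  have h₂₂₃ : f (g2 * g2 * g3) ∈ P := by simpa using sq₂ 1 g3 (by simpa) (by simpa)
  have h₁₂₂ : f (g1 * g2 * g2) ∈ P := by simpa using sq₂ g1 1 (by simpa) (by simpa)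
  have h₁₂₂₃ : f (g1 * g2 * g2 * g3) ∈ P := sq₂ g1 g3 h₁₃ h₁₂₃
  have h₂₁ : f (g2 * g1) ∈ P := by
    simpa using sw₁₂ 1 1 (by simpa) (by simpa) (by simpa) (by simpa)
  have h₁₂₁ : f (g1 * g2 * g1) ∈ P := by
    simpa using sw₁₂ g1 1 (by simpa) (by simpa) (by simpa) (by simpa)
  have h₂₁₃ : f (g2 * g1 * g3) ∈ P := by
    simpa using sw₁₂ 1 g3 (by simpa) (by simpa) (by simpa) (by simpa)
  have h₁₂₁₃ : f (g1 * g2 * g1 * g3) ∈ P := sw₁₂ g1 g3 h₁₃ h₁₁₃ h₁₂₃ h₁₁₂₃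
  obtain ⟨i, j, k⟩ := i
  have key : ∀ g, (g = g1 ∨ g = g2 ∨ g = g3) → f (gpow (i, j, k) * g) ∈ P := by
    rintro g (rfl | rfl | rfl)
    · fin_cases i <;> fin_cases j <;> fin_cases k <;> simp [gpow]
      · exact h₁
      · simpa using sw₁₃ 1 1 (by simpa) (by simpa) (by simpa) (by simpa)
      · exact h₂₁
      · simpa using sw₁₃ g2 1 (by simpa) (by simpa) (by simpa) (by simpa)
      · exact h₁₁
      · simpa using sw₁₃ g1 1 (by simpa) (by simpa) (by simpa) (by simpa)
      · exact h₁₂₁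
      · simpa using sw₁₃ (g1 * g2) 1 (by simpa) (by simpa) (by simpa) (by simpa)
    · fin_cases i <;> fin_cases j <;> fin_cases k <;> simp [gpow]
      · exact h₂
      · simpa using sw₂₃ 1 1 (by simpa) (by simpa) (by simpa) (by simpa)
      · exact h₂₂
      · simpa using sw₂₃ g2 1 (by simpa) (by simpa) (by simpa) (by simpa)
      · exact h₁₂
      · simpa using sw₂₃ g1 1 (by simpa) (by simpa) (by simpa) (by simpa)
      · exact h₁₂₂
      · simpa using sw₂₃ (g1 * g2) 1 (by simpa) (by simpa) (by simpa) (by simpa)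
    · fin_cases k
      · simpa [gpow] using h (i, j, 1)
      · have hu : f (g1 ^ (i : ℕ) * g2 ^ (j : ℕ) * 1) ∈ P := by simpa [gpow] using h (i, j, 0)
        have hv : f (g1 ^ (i : ℕ) * g2 ^ (j : ℕ) * g3 * 1) ∈ P := by
          simpa [gpow] using h (i, j, 1)
        simpa [gpow] using sq₃ _ 1 hu hv
  refine key _ ?_
  fin_cases l
  exacts [Or.inl rfl, Or.inr (Or.inl rfl), Or.inr (Or.inr rfl)]

theorem mem_mul (hP : ∀ i, ∀ x ∈ P, c i * x ∈ P) (w : F3) :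
    ∀ {f : F3 → A}, IsSkeinFunctional c f → (∀ i, f (gpow i) ∈ P) →
      ∀ i, f (gpow i * w) ∈ P := by
  induction w using FreeGroup.induction_on with
  | C1 => intro f _ h i; simpa using h i
  | of l => intro f hf h i; exact hf.mem_mul_generator hP h l i
  | inv_of l _ =>
    intro f hf h i
    obtain ⟨m, hm⟩ : ∃ m, word m = FreeGroup.of l := by
      fin_cases l
      exacts [⟨0, rfl⟩, ⟨1, rfl⟩, ⟨2, rfl⟩]
    have e := hf m (gpow i) 1
    simp only [mul_one, hm] at e
    change f (gpow i * (FreeGroup.of l)⁻¹) ∈ P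
    rw [eq_sub_of_add_eq' e]
    exact P.sub_mem (hP _ _ (h i)) (hf.mem_mul_generator hP h l i)
  | mul x y hx hy =>
    intro f hf h i
    simpa only [mul_assoc] using hx (hf.comp_mul_right y) (hy hf h) i

/-- The eight words `g₁^{i₁} g₂^{i₂} g₃^{i₃}` span, as far as skein functionals can see. -/
theorem mem (hf : IsSkeinFunctional c f) (hP : ∀ i, ∀ x ∈ P, c i * x ∈ P)
    (h : ∀ i, f (gpow i) ∈ P) (w : F3) : f w ∈ P := by
  simpa [gpow] using mem_mul hP w hf h (0, 0, 0)

end IsSkeinFunctional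

end Spanning

theorem isSkeinFunctional_cl : IsSkeinFunctional (fun i => cl ℂ (word i)) (cl ℂ) :=
  fun i u w => cl_insert u (word i) w

theorem isSkeinFunctional_cl_mul (α : F3) :
    IsSkeinFunctional (fun i => cl ℂ (word i)) fun w => cl ℂ (α * w) := fun i u w => by
  simpa only [mul_assoc] using cl_insert (R := ℂ) (α * u) (word i) w

theorem isSkeinFunctional_cl_mul_sub (α β : F3) :
    IsSkeinFunctional (fun i => cl ℂ (word i)) fun w => cl ℂ (α * w) - cl ℂ (β * w) :=
  fun i u w => by
    linear_combination isSkeinFunctional_cl_mul α i u w - isSkeinFunctional_cl_mul β i u w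

theorem Phi_X (i : Fin 7) : Phi (X i) = cl ℂ (word i) := by simp [Phi]

theorem Phi_surjective : Function.Surjective Phi := by
  rw [← AlgHom.range_eq_top]
  refine SkeinAlgebra.subalgebra_eq_top fun g => ?_
  refine isSkeinFunctional_cl.mem (P := (Subalgebra.toSubmodule Phi.range).toAddSubgroup) ?_ ?_ g
  · intro i x hx
    exact Phi.range.mul_mem ⟨X i, Phi_X i⟩ hx
  · rintro ⟨i, j, k⟩
    change ∃ x, Phi x = _
    fin_cases i <;> fin_cases j <;> fin_cases k <;> simp [gpow]
    · exact ⟨2, by rw [map_ofNat, cl_one]⟩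
    exacts [⟨X 2, Phi_X 2⟩, ⟨X 1, Phi_X 1⟩, ⟨X 5, Phi_X 5⟩, ⟨X 0, Phi_X 0⟩, ⟨X 4, Phi_X 4⟩,
      ⟨X 3, Phi_X 3⟩, ⟨X 6, Phi_X 6⟩]

/-- The sum of the two roots of `K` as a polynomial in `x₁₂₃`. -/
def rootSum : MvPolynomial (Fin 6) ℂ :=
  X 3 * X 2 + X 4 * X 1 + X 5 * X 0 - X 0 * X 1 * X 2

/-- The product of the two roots of `K` as a polynomial in `x₁₂₃`. -/
def rootProd : MvPolynomial (Fin 6) ℂ :=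
  X 0 ^ 2 + X 1 ^ 2 + X 2 ^ 2 + X 3 ^ 2 + X 5 ^ 2 + X 4 ^ 2
    - X 0 * X 1 * X 3 - X 0 * X 2 * X 4 - X 1 * X 2 * X 5 + X 3 * X 4 * X 5 - 4

theorem K_eq : K = X (Fin.last 6) ^ 2 - rename Fin.castSucc rootSum * X (Fin.last 6)
    + rename Fin.castSucc rootProd := by
  simp only [K, x1, x2, x3, x12, x13, x23, x123, rootSum, rootProd, map_add, map_sub, map_mul,
    map_pow, rename_X, map_ofNat]
  change _ = X 6 ^ 2 - (X 3 * X 2 + X 4 * X 1 + X 5 * X 0 - X 0 * X 1 * X 2) * X 6 +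
    (X 0 ^ 2 + X 1 ^ 2 + X 2 ^ 2 + X 3 ^ 2 + X 5 ^ 2 + X 4 ^ 2
    - X 0 * X 1 * X 3 - X 0 * X 2 * X 4 - X 1 * X 2 * X 5 + X 3 * X 4 * X 5 - 4)
  ring

theorem exists_eq_add_mul_X_add_mul_K (p : MvPolynomial (Fin 7) ℂ) :
    ∃ (a b : MvPolynomial (Fin 6) ℂ) (q : MvPolynomial (Fin 7) ℂ),
      p = rename Fin.castSucc a + rename Fin.castSucc b * X (Fin.last 6) + q * K := by
  induction p using MvPolynomial.induction_on with
  | C r => exact ⟨C r, 0, 0, by simp⟩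
  | add p p' hp hp' =>
    obtain ⟨a, b, q, rfl⟩ := hp
    obtain ⟨a', b', q', rfl⟩ := hp'
    exact ⟨a + a', b + b', q + q', by simp only [map_add]; ring⟩
  | mul_X p i hp =>
    obtain ⟨a, b, q, rfl⟩ := hp
    refine Fin.lastCases ?_ (fun j => ?_) i
    · refine ⟨-(b * rootProd), a + b * rootSum, q * X (Fin.last 6) + rename Fin.castSucc b, ?_⟩
      simp only [map_add, map_mul, map_neg, K_eq]
      ring
    · refine ⟨a * X j, b * X j, q * X j.castSucc, ?_⟩
      simp only [map_mul, rename_X]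
      ring

theorem Phi_K : Phi K = 0 := by
  have h₁ := cl_mul_add_cl_mul_swap (R := ℂ) g1 g2 g3
  have h₂ := cl_mul_mul_cl_swap (R := ℂ) g1 g2 g3
  simp only [K, x1, x2, x3, x12, x13, x23, x123, map_add, map_sub, map_mul, map_pow, Phi_X,
    map_ofNat]
  change cl ℂ (g1 * g2 * g3) ^ 2 - (cl ℂ (g1 * g2) * cl ℂ g3 + cl ℂ (g1 * g3) * cl ℂ g2
    + cl ℂ (g2 * g3) * cl ℂ g1 - cl ℂ g1 * cl ℂ g2 * cl ℂ g3) * cl ℂ (g1 * g2 * g3)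
    + cl ℂ g1 ^ 2 + cl ℂ g2 ^ 2 + cl ℂ g3 ^ 2 + cl ℂ (g1 * g2) ^ 2 + cl ℂ (g2 * g3) ^ 2
    + cl ℂ (g1 * g3) ^ 2 - cl ℂ g1 * cl ℂ g2 * cl ℂ (g1 * g2)
    - cl ℂ g1 * cl ℂ g3 * cl ℂ (g1 * g3) - cl ℂ g2 * cl ℂ g3 * cl ℂ (g2 * g3)
    + cl ℂ (g1 * g2) * cl ℂ (g1 * g3) * cl ℂ (g2 * g3) - 4 = 0
  linear_combination cl ℂ (g1 * g2 * g3) * h₁ - h₂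

/-- The polynomial `tr [A, B] - 2` in `tr A`, `tr B` and `tr (A * B)`, for `A, B` in `SL₂`. -/
def commutatorPoly (i j k : Fin 6) : MvPolynomial (Fin 6) ℂ :=
  X i ^ 2 + X j ^ 2 + X k ^ 2 - X i * X j * X k - 4

theorem exists_trace_eq (x : Fin 6 → ℂ) (h₀ : x 0 ^ 2 - 4 ≠ 0)
    (h₁ : eval x (commutatorPoly 0 1 3) ≠ 0) (h₂ : eval x (commutatorPoly 0 2 4) ≠ 0) :
    ∃ A B C : Matrix.SpecialLinearGroup (Fin 2) ℂ,
      A.1.trace = x 0 ∧ B.1.trace = x 1 ∧ C.1.trace = x 2 ∧ (A * B).1.trace = x 3 ∧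
        (A * C).1.trace = x 4 ∧ (B * C).1.trace = x 5 := by
  have root : ∀ a b c : ℂ, a ≠ 0 → ∃ r, a * (r * r) + b * r + c = 0 := fun a b c ha =>
    exists_quadratic_eq_zero ha (IsAlgClosed.exists_eq_mul_self _)
  obtain ⟨s, hs⟩ := root 1 (-x 0) 1 one_ne_zero
  obtain ⟨t, ht⟩ : ∃ t, t = x 0 - s := ⟨_, rfl⟩
  have hst : s * t = 1 := by rw [ht]; linear_combination -hs
  have hsub : s - t ≠ 0 := by
    intro h
    apply h₀
    have : x 0 = s + t := by rw [ht]; ring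
    rw [this]
    linear_combination (s - t) * h + 4 * hst
  have solve : ∀ y z : ℂ, ∃ a d, a + d = y ∧ s * a + t * d = z ∧
      (s - t) ^ 2 * (a * d - 1) = -(x 0 ^ 2 + y ^ 2 + z ^ 2 - x 0 * y * z - 4) := by
    intro y z
    have ha : (s - t) * ((z - t * y) / (s - t)) = z - t * y := mul_div_cancel₀ _ hsub
    have hd : (s - t) * ((s * y - z) / (s - t)) = s * y - z := mul_div_cancel₀ _ hsub
    generalize (z - t * y) / (s - t) = a at *
    generalize (s * y - z) / (s - t) = d at *
    refine ⟨a, d, ?_, ?_, ?_⟩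
    · apply mul_left_cancel₀ hsub
      linear_combination ha + hd
    · apply mul_left_cancel₀ hsub
      linear_combination s * ha + t * hd
    · have : x 0 = s + t := by rw [ht]; ring
      rw [this]
      linear_combination (s - t) * d * ha + (z - t * y) * hd + (4 - y ^ 2) * hst
  obtain ⟨a, d, had, hsad, hk⟩ := solve (x 1) (x 3)
  obtain ⟨b, e, hbe, hsbe, hm⟩ := solve (x 2) (x 4)
  simp only [commutatorPoly, map_sub, map_add, map_mul, map_pow, eval_X, map_ofNat] at h₁ h₂
  have hk₀ : a * d - 1 ≠ 0 := by
    intro h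
    rw [h, mul_zero] at hk
    exact h₁ (neg_eq_zero.1 hk.symm)
  have hm₀ : b * e - 1 ≠ 0 := by
    intro h
    rw [h, mul_zero] at hm
    exact h₂ (neg_eq_zero.1 hm.symm)
  obtain ⟨u, hu⟩ := root (a * d - 1) (a * b + d * e - x 5) (b * e - 1) hk₀
  have hu₀ : u ≠ 0 := by
    rintro rfl
    exact hm₀ (by simpa using hu)
  have hv : (b * e - 1) / u * u = b * e - 1 := div_mul_cancel₀ _ hu₀
  generalize (b * e - 1) / u = v at hv
  have lift : ∀ M : Matrix (Fin 2) (Fin 2) ℂ, M.det = 1 →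
      ∃ A : Matrix.SpecialLinearGroup (Fin 2) ℂ, A.1 = M := fun M hM => ⟨⟨M, hM⟩, rfl⟩
  obtain ⟨A, hA⟩ := lift !![s, 0; 0, t] (by simp [Matrix.det_fin_two, hst])
  obtain ⟨B, hB⟩ := lift !![a, 1; a * d - 1, d] (by simp [Matrix.det_fin_two])
  obtain ⟨C, hC⟩ := lift !![b, u; v, e] (by
    rw [Matrix.det_fin_two_of]
    linear_combination -hv)
  refine ⟨A, B, C, ?_⟩
  simp only [Matrix.SpecialLinearGroup.coe_mul, hA, hB, hC, Matrix.mul_fin_two,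
    Matrix.trace_fin_two_of]
  refine ⟨by rw [ht]; ring, had, hbe, by linear_combination hsad,
    by linear_combination hsbe, ?_⟩
  apply mul_left_cancel₀ hu₀
  linear_combination hu + hv

/-- The polynomial whose nonvanishing guarantees that both roots of `K` are traces of the
product of three matrices with the given six traces. -/
def genericPoly : MvPolynomial (Fin 6) ℂ :=
  (X 0 ^ 2 - 4) * commutatorPoly 0 1 3 * commutatorPoly 0 2 4 * (rootSum ^ 2 - 4 * rootProd)

theorem genericPoly_ne_zero : genericPoly ≠ 0 := by
  intro h
  have := congrArg (eval 0) h
  norm_num [genericPoly, commutatorPoly, rootSum, rootProd, -eval_zero] at this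

theorem eval_add_eval_mul_trace {a b : MvPolynomial (Fin 6) ℂ}
    (h : Phi (rename Fin.castSucc a + rename Fin.castSucc b * X (Fin.last 6)) = 0)
    (x : Fin 6 → ℂ) (A B C : Matrix.SpecialLinearGroup (Fin 2) ℂ)
    (hA : A.1.trace = x 0) (hB : B.1.trace = x 1) (hC : C.1.trace = x 2)
    (hAB : (A * B).1.trace = x 3) (hAC : (A * C).1.trace = x 4) (hBC : (B * C).1.trace = x 5) :
    eval x a + eval x b * (A * B * C).1.trace = 0 := by
  have key : ((SkeinAlgebra.trace (FreeGroup.lift ![A, B, C])).comp Phi) =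
      aeval (Fin.snoc x (A * B * C).1.trace) := by
    ext i
    rw [AlgHom.comp_apply, Phi_X, aeval_X, SkeinAlgebra.trace, SkeinAlgebra.lift_cl]
    fin_cases i <;> simp only [word, g1, g2, g3]
    · exact Eq.trans (by simp) hA
    · exact Eq.trans (by simp) hB
    · exact Eq.trans (by simp) hC
    · exact Eq.trans (by simp) hAB
    · exact Eq.trans (by simp) hAC
    · exact Eq.trans (by simp) hBC
    · simp [Fin.snoc]
  have h' := congrArg (SkeinAlgebra.trace (FreeGroup.lift ![A, B, C])) h
  rw [← AlgHom.comp_apply, key] at h'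
  simp only [map_add, map_mul, map_zero, aeval_rename, aeval_X, Fin.snoc_last] at h'
  have hx : (Fin.snoc x (A * B * C).1.trace : Fin 7 → ℂ) ∘ Fin.castSucc = x := by
    ext i; simp
  simpa [hx] using h'

theorem trace_sub_sq (x : Fin 6 → ℂ) (A B C : Matrix.SpecialLinearGroup (Fin 2) ℂ)
    (hA : A.1.trace = x 0) (hB : B.1.trace = x 1) (hC : C.1.trace = x 2)
    (hAB : (A * B).1.trace = x 3) (hAC : (A * C).1.trace = x 4) (hBC : (B * C).1.trace = x 5) :
    ((A * B * C).1.trace - (A * C * B).1.trace) ^ 2 =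
      eval x (rootSum ^ 2 - 4 * rootProd) := by
  have h₁ := congrArg (SkeinAlgebra.trace (MonoidHom.id _)) (cl_mul_add_cl_mul_swap A B C)
  have h₂ := congrArg (SkeinAlgebra.trace (MonoidHom.id _)) (cl_mul_mul_cl_swap A B C)
  simp only [SkeinAlgebra.trace, map_add, map_sub, map_mul, map_pow, map_ofNat,
    SkeinAlgebra.lift_cl, MonoidHom.id_apply, hA, hB, hC, hAB, hAC, hBC] at h₁ h₂
  simp only [rootSum, rootProd, map_add, map_sub, map_mul, map_pow, map_ofNat, eval_X]
  rw [← h₁, ← h₂]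
  ring

theorem eq_zero_of_Phi_eq_zero {a b : MvPolynomial (Fin 6) ℂ}
    (h : Phi (rename Fin.castSucc a + rename Fin.castSucc b * X (Fin.last 6)) = 0) :
    a = 0 ∧ b = 0 := by
  have key : ∀ x, eval x genericPoly ≠ 0 → eval x a = 0 ∧ eval x b = 0 := by
    intro x hx
    simp only [genericPoly, map_mul (eval x)] at hx
    obtain ⟨⟨⟨h₀, h₁⟩, h₂⟩, h₃⟩ :
        ((x 0 ^ 2 - 4 ≠ 0 ∧ eval x (commutatorPoly 0 1 3) ≠ 0) ∧
          eval x (commutatorPoly 0 2 4) ≠ 0) ∧ eval x (rootSum ^ 2 - 4 * rootProd) ≠ 0 := by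
      simpa only [mul_ne_zero_iff, map_sub, map_pow, eval_X, map_ofNat, map_mul] using hx
    obtain ⟨A, B, C, hA, hB, hC, hAB, hAC, hBC⟩ := exists_trace_eq x h₀ h₁ h₂
    have e₁ := eval_add_eval_mul_trace h x A B C hA hB hC hAB hAC hBC
    have htr : ∀ M N : Matrix.SpecialLinearGroup (Fin 2) ℂ,
        (M.transpose * N.transpose).1.trace = (M * N).1.trace := fun M N => by
      simp only [Matrix.SpecialLinearGroup.coe_mul, Matrix.SpecialLinearGroup.coe_transpose]
      rw [← Matrix.transpose_mul, Matrix.trace_transpose, Matrix.trace_mul_comm]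
    have e₂ := eval_add_eval_mul_trace h x A.transpose B.transpose C.transpose
      (by simpa using hA) (by simpa using hB) (by simpa using hC) (by rw [htr, hAB])
      (by rw [htr, hAC]) (by rw [htr, hBC])
    have htr₃ : (A.transpose * B.transpose * C.transpose).1.trace = (A * C * B).1.trace := by
      simp only [Matrix.SpecialLinearGroup.coe_mul, Matrix.SpecialLinearGroup.coe_transpose]
      rw [← Matrix.transpose_mul, ← Matrix.transpose_mul, Matrix.trace_transpose,
        ← Matrix.mul_assoc, Matrix.trace_mul_comm, Matrix.mul_assoc]
    rw [htr₃] at e₂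
    have hd := trace_sub_sq x A B C hA hB hC hAB hAC hBC
    have hne : (A * B * C).1.trace - (A * C * B).1.trace ≠ 0 := by
      intro h0
      rw [h0] at hd
      exact h₃ (by simpa using hd.symm)
    have hb : eval x b = 0 := by
      refine (mul_eq_zero.1 (?_ : eval x b * _ = 0)).resolve_right hne
      linear_combination e₁ - e₂
    exact ⟨by simpa [hb] using e₁, hb⟩
  have of_generic : ∀ p : MvPolynomial (Fin 6) ℂ,
      (∀ x, eval x genericPoly ≠ 0 → eval x p = 0) → p = 0 := by
    intro p hp
    refine (mul_eq_zero.1 (?_ : p * genericPoly = 0)).resolve_right genericPoly_ne_zero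
    refine MvPolynomial.funext fun x => ?_
    by_cases hx : eval x genericPoly = 0
    · simp [hx]
    · simp [hp x hx]
  exact ⟨of_generic a fun x hx => (key x hx).1, of_generic b fun x hx => (key x hx).2⟩

theorem ker_Phi : RingHom.ker Phi = Ideal.span {K} := by
  apply le_antisymm
  · intro p hp
    obtain ⟨a, b, q, rfl⟩ := exists_eq_add_mul_X_add_mul_K p
    rw [RingHom.mem_ker, map_add, map_mul Phi q, Phi_K, mul_zero, add_zero] at hp
    obtain ⟨rfl, rfl⟩ := eq_zero_of_Phi_eq_zero hp
    simpa using Ideal.mul_mem_left _ q (Ideal.mem_span_singleton_self K)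
  · rw [Ideal.span_singleton_le_iff_mem, RingHom.mem_ker, Phi_K]

/-- If `[n * w] = [w]` modulo `I` for all `n` in a set of relators, then `I` contains the
kernel of the map to the skein algebra of the quotient. -/
theorem SkeinAlgebra.ker_map_mk_le {R G : Type*} [CommRing R] [Group G] (S : Set G)
    (I : Ideal (SkeinAlgebra R G)) (hS : ∀ n ∈ S, ∀ w, cl R (n * w) - cl R w ∈ I) :
    RingHom.ker (SkeinAlgebra.map (R := R) (QuotientGroup.mk' (Subgroup.normalClosure S))) ≤
      I := by
  let T : Subgroup G :=
    { carrier := {n | ∀ w, cl R (n * w) - cl R w ∈ I}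
      one_mem' := fun w => by simp
      mul_mem' := fun {m n} hm hn w => by
        simpa [mul_assoc] using I.add_mem (hm (n * w)) (hn w)
      inv_mem' := fun {n} hn w => by
        simpa using I.neg_mem (hn (n⁻¹ * w)) }
  have hT : T.Normal := ⟨fun n hn g w => by
    have h := hn (g⁻¹ * w * g)
    rw [cl_mul_comm (g⁻¹ * w), mul_inv_cancel_left, ← mul_assoc, cl_mul_comm _ g] at h
    simpa only [mul_assoc] using h⟩
  have hN : Subgroup.normalClosure S ≤ T := Subgroup.normalClosure_le_normal hS
  have hmk : ∀ g h : G, (g : G ⧸ Subgroup.normalClosure S) = h →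
      Ideal.Quotient.mk I (cl R g) = Ideal.Quotient.mk I (cl R h) := by
    intro g h hgh
    rw [Ideal.Quotient.mk_eq_mk_iff_sub_mem]
    have := hN ((Subgroup.normalClosure_normal.mem_comm (QuotientGroup.eq.1 hgh.symm))) h
    simpa using this
  let f : G ⧸ Subgroup.normalClosure S → SkeinAlgebra R G ⧸ I :=
    fun q => Ideal.Quotient.mk I (cl R q.out)
  have hf : ∀ g : G, f g = Ideal.Quotient.mk I (cl R g) := fun g =>
    hmk _ _ (QuotientGroup.out_eq' _)
  let ψ : SkeinAlgebra R (G ⧸ Subgroup.normalClosure S) →ₐ[R] SkeinAlgebra R G ⧸ I :=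
    SkeinAlgebra.lift f (by rw [← QuotientGroup.mk_one, hf, cl_one, map_ofNat]) (by
      intro q r
      induction q using QuotientGroup.induction_on with | _ g
      induction r using QuotientGroup.induction_on with | _ h
      rw [← QuotientGroup.mk_inv, ← QuotientGroup.mk_mul, ← QuotientGroup.mk_mul]
      simp only [hf, ← map_mul, ← map_add, cl_mul])
  have hψ : ψ.comp (SkeinAlgebra.map (QuotientGroup.mk' _)) = Ideal.Quotient.mkₐ R I := by
    rw [← AlgHom.equalizer_eq_top]
    refine SkeinAlgebra.subalgebra_eq_top fun g => ?_
    simp [ψ, SkeinAlgebra.map, hf]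
  intro x hx
  rw [← Ideal.Quotient.eq_zero_iff_mem]
  have h := DFunLike.congr_fun hψ x
  rw [AlgHom.comp_apply, RingHom.mem_ker.1 hx, map_zero] at h
  exact h.symm

/-- Theorem 2: for the group `G` presented by three generators and the two relations
`α = β`, `γ = δ`, the ideal `I_G = ker Φ_G` is generated by `K` together with the
sixteen polynomials `P_{αg} - P_{βg}`, `P_{γg} - P_{δg}`,
`g = g₁^{i₁}g₂^{i₂}g₃^{i₃}`, `0 ≤ i₁,i₂,i₃ ≤ 1`. -/
theorem skein_two_relators (α β γ δ : F3)
    (Pa Pb Pc Pd : Fin 2 × Fin 2 × Fin 2 → MvPolynomial (Fin 7) ℂ)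
    (hPa : ∀ i, Phi (Pa i) = cl ℂ (α * gpow i))
    (hPb : ∀ i, Phi (Pb i) = cl ℂ (β * gpow i))
    (hPc : ∀ i, Phi (Pc i) = cl ℂ (γ * gpow i))
    (hPd : ∀ i, Phi (Pd i) = cl ℂ (δ * gpow i)) :
    letI N : Subgroup F3 := Subgroup.normalClosure {α * β⁻¹, γ * δ⁻¹}
    letI ι : F3 →* F3 ⧸ N := QuotientGroup.mk' N
    letI PhiG : MvPolynomial (Fin 7) ℂ →ₐ[ℂ] SkeinAlgebra ℂ (F3 ⧸ N) :=
      aeval fun i => cl ℂ (ι (word i))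
    RingHom.ker PhiG =
      Ideal.span ({K} ∪ Set.range (fun i => Pa i - Pb i) ∪
        Set.range (fun i => Pc i - Pd i)) := by
  set N : Subgroup F3 := Subgroup.normalClosure {α * β⁻¹, γ * δ⁻¹}
  set ι : F3 →* F3 ⧸ N := QuotientGroup.mk' N
  set PhiG : MvPolynomial (Fin 7) ℂ →ₐ[ℂ] SkeinAlgebra ℂ (F3 ⧸ N) :=
    aeval fun i => cl ℂ (ι (word i)) with hPhi
  have hcomp : PhiG = (SkeinAlgebra.map ι).comp Phi := by
    ext i
    simp [hPhi, Phi_X, SkeinAlgebra.map]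
  have hPhiG : ∀ p, PhiG p = SkeinAlgebra.map ι (Phi p) := fun p => by rw [hcomp]; rfl
  set J := Ideal.span ({K} ∪ Set.range (fun i => Pa i - Pb i) ∪
    Set.range (fun i => Pc i - Pd i))
  apply le_antisymm
  · have hmem : ∀ {p}, p ∈ ({K} ∪ Set.range (fun i => Pa i - Pb i) ∪
        Set.range (fun i => Pc i - Pd i) : Set (MvPolynomial (Fin 7) ℂ)) →
        Phi p ∈ J.map Phi := fun hp => Ideal.mem_map_of_mem _ (Ideal.subset_span hp)
    have hrel : ∀ α β : F3, (∀ i, cl ℂ (α * gpow i) - cl ℂ (β * gpow i) ∈ J.map Phi) →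
        ∀ w, cl ℂ (α * β⁻¹ * w) - cl ℂ w ∈ J.map Phi := by
      intro α β h w
      simpa [mul_assoc] using (isSkeinFunctional_cl_mul_sub α β).mem
        (P := (J.map Phi).toAddSubgroup) (fun i x hx => Ideal.mul_mem_left _ _ hx) h (β⁻¹ * w)
    have hle := SkeinAlgebra.ker_map_mk_le (R := ℂ) {α * β⁻¹, γ * δ⁻¹} (J.map Phi) (by
      rintro n (rfl | rfl)
      · refine hrel α β fun i => ?_
        rw [← hPa, ← hPb, ← map_sub]
        exact hmem (Or.inl (Or.inr ⟨i, rfl⟩))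
      · refine hrel γ δ fun i => ?_
        rw [← hPc, ← hPd, ← map_sub]
        exact hmem (Or.inr ⟨i, rfl⟩))
    intro p hp
    have h₁ : Phi p ∈ J.map Phi := hle (by rw [RingHom.mem_ker, ← hPhiG]; exact hp)
    have h₂ := Ideal.comap_map_of_surjective' Phi Phi_surjective J
    have h₃ : p ∈ J ⊔ RingHom.ker Phi := h₂ ▸ Ideal.mem_comap.2 h₁
    rw [ker_Phi, sup_eq_left.2 (Ideal.span_mono (by simp))] at h₃
    exact h₃
  · have hrel : ∀ α β : F3, α * β⁻¹ ∈ N → ∀ w, cl ℂ (ι (α * w)) = cl ℂ (ι (β * w)) := by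
      intro α β h w
      have : ι (α * β⁻¹) = 1 := (QuotientGroup.eq_one_iff _).2 h
      rw [map_mul, map_inv, mul_inv_eq_one] at this
      rw [map_mul, map_mul, this]
    refine Ideal.span_le.2 ?_
    rintro _ ((rfl | ⟨i, rfl⟩) | ⟨i, rfl⟩)
    · simp [RingHom.mem_ker, hPhiG, Phi_K]
    · have := hrel α β (Subgroup.subset_normalClosure (by simp)) (gpow i)
      simp [RingHom.mem_ker, hPhiG, hPa, hPb, SkeinAlgebra.map, this, -map_mul]
    · have := hrel γ δ (Subgroup.subset_normalClosure (by simp)) (gpow i)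
      simp [RingHom.mem_ker, hPhiG, hPc, hPd, SkeinAlgebra.map, this, -map_mul]
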